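/- Let n ≥ 2 and let A₁, A₂, B be as in the multiplex construction (B is the combined-layer matrix built from the row-stochastic, symmetric-support layer matrices A₁, A₂, with B irreducible and every strongly connected component of each layer containing an odd closed walk). Then the product matrix C' = B · A₁ is primitive, i.e., there exists m ≥ 1 such that every entry of (B·A₁)^m is strictly positive. -/

import Mathlib

open Matrix

section NonnegativeMatrices

variable {ι : Type*} [Fintype ι]

theorem mul_apply_pos_iff {M N : Matrix ι ι ℝ} (hM : ∀ i j, 0 ≤ M i j) (hN : ∀ i j, 0 ≤ N i j)
    (i j : ι) : 0 < (M * N) i j ↔ ∃ k, 0 < M i k ∧ 0 < N k j := by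
  rw [Matrix.mul_apply, Finset.sum_pos_iff_of_nonneg fun k _ => mul_nonneg (hM i k) (hN k j)]
  constructor
  · rintro ⟨k, -, hk⟩
    exact ⟨k, pos_of_mul_pos_left hk (hN k j), pos_of_mul_pos_right hk (hM i k)⟩
  · rintro ⟨k, hik, hkj⟩
    exact ⟨k, Finset.mem_univ k, mul_pos hik hkj⟩

theorem mul_apply_nonneg {M N : Matrix ι ι ℝ} (hM : ∀ i j, 0 ≤ M i j) (hN : ∀ i j, 0 ≤ N i j)
    (i j : ι) : 0 ≤ (M * N) i j := by
  rw [Matrix.mul_apply]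
  exact Finset.sum_nonneg fun k _ => mul_nonneg (hM i k) (hN k j)

theorem exists_pos_of_row_sum_eq_one {M : Matrix ι ι ℝ} {i : ι} (hrow : ∑ j, M i j = 1) :
    ∃ j, 0 < M i j := by
  by_contra! h
  have := Finset.sum_nonpos fun j (_ : j ∈ Finset.univ) => h j
  linarith

variable [DecidableEq ι]

theorem pow_add_apply_pos {M : Matrix ι ι ℝ} (hM : ∀ i j, 0 ≤ M i j) {a b : ℕ} {i j k : ι}
    (hij : 0 < (M ^ a) i j) (hjk : 0 < (M ^ b) j k) : 0 < (M ^ (a + b)) i k := by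
  rw [pow_add, mul_apply_pos_iff (pow_apply_nonneg hM a) (pow_apply_nonneg hM b)]
  exact ⟨j, hij, hjk⟩

theorem pow_mul_apply_self_pos {M : Matrix ι ι ℝ} (hM : ∀ i j, 0 ≤ M i j) {a : ℕ} {i : ι}
    (h : 0 < (M ^ a) i i) (m : ℕ) : 0 < (M ^ (a * m)) i i := by
  induction m with
  | zero => simp
  | succ m ih => rw [Nat.mul_succ]; exact pow_add_apply_pos hM ih h

theorem reflTransGen_iff_exists_pow_pos {M : Matrix ι ι ℝ} (hM : ∀ i j, 0 ≤ M i j) (i j : ι) :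
    Relation.ReflTransGen (fun i j => 0 < M i j) i j ↔ ∃ m, 0 < (M ^ m) i j := by
  constructor
  · intro h
    induction h with
    | refl => exact ⟨0, by simp⟩
    | tail _ hjk ih =>
      obtain ⟨m, hm⟩ := ih
      exact ⟨m + 1, pow_add_apply_pos hM hm (by simpa using hjk)⟩
  · rintro ⟨m, hm⟩
    induction m generalizing j with
    | zero =>
      obtain rfl : i = j := by
        by_contra hne
        simp [Matrix.one_apply_ne hne] at hm
      exact .refl
    | succ m ih =>
      rw [pow_succ, mul_apply_pos_iff (pow_apply_nonneg hM m) hM] at hm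
      obtain ⟨k, hik, hkj⟩ := hm
      exact (ih k hik).tail hkj

theorem eq_of_diag_eq_one {M : Matrix ι ι ℝ} (hM : ∀ i j, 0 ≤ M i j) {i j : ι}
    (hrow : ∑ j, M i j = 1) (hii : M i i = 1) (hij : 0 < M i j) : i = j := by
  by_contra hne
  have h := Finset.sum_le_sum_of_subset_of_nonneg (Finset.subset_univ {i, j})
    fun k _ _ => hM i k
  rw [Finset.sum_pair hne] at h
  linarith

theorem eq_one_of_diag_eq_one {M : Matrix ι ι ℝ} (hM : ∀ i j, 0 ≤ M i j) {i : ι}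
    (hrow : ∑ j, M i j = 1) (hii : M i i = 1) (j : ι) : M i j = (1 : Matrix ι ι ℝ) i j := by
  by_cases hij : i = j
  · subst hij; simpa using hii
  · rw [Matrix.one_apply_ne hij]
    exact le_antisymm (not_lt.mp fun h => hij (eq_of_diag_eq_one hM hrow hii h)) (hM i j)

/-- An irreducible nonnegative matrix with closed walks of all large lengths at some vertex is
primitive. -/
theorem exists_pow_pos_of_eventually_diag_pos {M : Matrix ι ι ℝ} (hM : ∀ i j, 0 ≤ M i j)
    (hirr : ∀ i j, ∃ m, 0 < (M ^ m) i j) (v : ι) (N : ℕ)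
    (hv : ∀ m, N ≤ m → 0 < (M ^ m) v v) : ∃ m, 1 ≤ m ∧ ∀ i j, 0 < (M ^ m) i j := by
  choose d hd using hirr
  set a := Finset.univ.sup fun i => d i v
  set b := Finset.univ.sup fun j => d v j
  refine ⟨N + a + b + 1, by omega, fun i j => ?_⟩
  have ha : d i v ≤ a := Finset.le_sup (f := fun i => d i v) (Finset.mem_univ i)
  have hb : d v j ≤ b := Finset.le_sup (f := fun j => d v j) (Finset.mem_univ j)
  have hlen : N + a + b + 1 = d i v + (N + a + b + 1 - d i v - d v j) + d v j := by omega
  rw [hlen]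
  exact pow_add_apply_pos hM (pow_add_apply_pos hM (hd i v) (hv _ (by omega))) (hd v j)

end NonnegativeMatrices

/-- In the multiplex construction, the product matrix `C' = B * A₁`
is primitive. -/
theorem multiplex_product_primitive (n : ℕ) (hn : 2 ≤ n)
    (A₁ A₂ B : Matrix (Fin n) (Fin n) ℝ)
    -- A₁, A₂ are row-stochastic
    (hA₁nonneg : ∀ i j, 0 ≤ A₁ i j) (hA₁row : ∀ i, ∑ j, A₁ i j = 1)
    (hA₂nonneg : ∀ i j, 0 ≤ A₂ i j) (hA₂row : ∀ i, ∑ j, A₂ i j = 1)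
    -- symmetric support
    (hA₁sym : ∀ i j, 0 < A₁ i j ↔ 0 < A₁ j i)
    (hA₂sym : ∀ i j, 0 < A₂ i j ↔ 0 < A₂ j i)
    -- every strongly connected component of each layer contains an odd closed walk
    (hA₁odd : ∀ i, ∃ ℓ, 1 ≤ ℓ ∧ Odd ℓ ∧ 0 < (A₁ ^ ℓ) i i)
    (hA₂odd : ∀ i, ∃ ℓ, 1 ≤ ℓ ∧ Odd ℓ ∧ 0 < (A₂ ^ ℓ) i i)
    -- the combined-layer matrix B, defined row-wise
    (hB : ∀ i j, B i j =
      if A₂ i i = 1 then A₁ i j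
      else if A₁ i i = 1 then A₂ i j
      else (A₁ i j + A₂ i j) / 2)
    -- B is irreducible
    (hBirr : ∀ i j, ∃ m, 1 ≤ m ∧ 0 < (B ^ m) i j) :
    -- conclusion: B * A₁ is primitive
    ∃ m, 1 ≤ m ∧ ∀ i j, 0 < ((B * A₁) ^ m) i j := by
  have hBnonneg : ∀ i j, 0 ≤ B i j := by
    intro i j
    have h₁ := hA₁nonneg i j
    have h₂ := hA₂nonneg i j
    rw [hB]
    split_ifs <;> linarith
  have hCnonneg := mul_apply_nonneg hBnonneg hA₁nonneg
  have hBpos : ∀ i j, A₁ i i ≠ 1 → 0 < A₁ i j → 0 < B i j := by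
    intro i j hii hij
    have h₂ := hA₂nonneg i j
    rw [hB, if_neg hii]
    split_ifs <;> linarith
  have htwo : ∀ i j, 0 < (A₁ ^ 2) i j →
      Relation.ReflTransGen (fun i j => 0 < (B * A₁) i j) i j := by
    intro i j hij
    rw [pow_two, mul_apply_pos_iff hA₁nonneg hA₁nonneg] at hij
    obtain ⟨k, hik, hkj⟩ := hij
    by_cases hii : A₁ i i = 1
    · obtain rfl := eq_of_diag_eq_one hA₁nonneg (hA₁row i) hii hik
      obtain rfl := eq_of_diag_eq_one hA₁nonneg (hA₁row i) hii hkj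
      exact .refl
    · exact .single ((mul_apply_pos_iff hBnonneg hA₁nonneg i j).2 ⟨k, hBpos i k hii hik, hkj⟩)
  have hback : ∀ i j, 0 < A₁ i j →
      Relation.ReflTransGen (fun i j => 0 < (B * A₁) i j) i j := by
    intro i j hij
    obtain ⟨ℓ, -, ⟨t, rfl⟩, hℓ⟩ := hA₁odd j
    have h := pow_add_apply_pos hA₁nonneg (a := 1) (by simpa using hij) hℓ
    rw [show 1 + (2 * t + 1) = 2 * (t + 1) by ring, pow_mul] at h
    have h' := (reflTransGen_iff_exists_pow_pos (pow_apply_nonneg hA₁nonneg 2) i j).2 ⟨_, h⟩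
    exact Relation.reflTransGen_closed htwo _ _ h'
  have hedge : ∀ i j, 0 < B i j →
      Relation.ReflTransGen (fun i j => 0 < (B * A₁) i j) i j := by
    intro i j hij
    obtain ⟨k, hjk⟩ := exists_pos_of_row_sum_eq_one (hA₁row j)
    exact (hback k j ((hA₁sym j k).1 hjk)).head
      ((mul_apply_pos_iff hBnonneg hA₁nonneg i k).2 ⟨j, hij, hjk⟩)
  have hCirr : ∀ i j, ∃ m, 0 < ((B * A₁) ^ m) i j := by
    intro i j
    obtain ⟨m, -, hm⟩ := hBirr i j
    have h := (reflTransGen_iff_exists_pow_pos hBnonneg i j).2 ⟨m, hm⟩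
    rw [← reflTransGen_iff_exists_pow_pos hCnonneg]
    exact Relation.reflTransGen_closed hedge _ _ h
  by_cases htriv : ∀ i, A₁ i i = 1
  · have hone : A₁ = 1 := by
      ext i j
      exact eq_one_of_diag_eq_one hA₁nonneg (hA₁row i) (htriv i) j
    have hBA₂ : B * A₁ = A₂ := by
      rw [hone, mul_one]
      ext i j
      rw [hB, if_pos (htriv i)]
      split_ifs with h
      · rw [eq_one_of_diag_eq_one hA₂nonneg (hA₂row i) h, hone]
      · rfl
    rw [hBA₂] at hCirr ⊢
    let v : Fin n := ⟨0, by omega⟩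
    obtain ⟨ℓ, -, hodd, hℓ⟩ := hA₂odd v
    obtain ⟨k, hvk⟩ := exists_pos_of_row_sum_eq_one (hA₂row v)
    have hsq : 0 < (A₂ ^ 2) v v := by
      rw [pow_two, mul_apply_pos_iff hA₂nonneg hA₂nonneg]
      exact ⟨k, hvk, (hA₂sym v k).1 hvk⟩
    refine exists_pow_pos_of_eventually_diag_pos hA₂nonneg hCirr v ℓ fun m hm => ?_
    rcases Nat.even_or_odd' m with ⟨t, rfl | rfl⟩
    · exact pow_mul_apply_self_pos hA₂nonneg hsq t
    · obtain ⟨s, rfl⟩ := hodd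
      rw [show 2 * t + 1 = 2 * s + 1 + 2 * (t - s) by omega]
      exact pow_add_apply_pos hA₂nonneg hℓ (pow_mul_apply_self_pos hA₂nonneg hsq (t - s))
  · push Not at htriv
    obtain ⟨v, hv⟩ := htriv
    obtain ⟨k, hvk⟩ := exists_pos_of_row_sum_eq_one (hA₁row v)
    have hloop : 0 < ((B * A₁) ^ 1) v v := by
      rw [pow_one, mul_apply_pos_iff hBnonneg hA₁nonneg]
      exact ⟨k, hBpos v k hv hvk, (hA₁sym v k).1 hvk⟩
    refine exists_pow_pos_of_eventually_diag_pos hCnonneg hCirr v 0 fun m _ => ?_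
    simpa using pow_mul_apply_self_pos hCnonneg hloop m
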